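/- arXiv:0906.5313 — 2 statements merged into one kernel-verified Lean document; each statement's English description precedes it below -/
import Mathlib

section
/- Let δ ∈ ℂ \ ℤ, let z ∈ (−1,1) be real, and let h be real with 0 < h < 1. Set w = √(1+h²−2hz) > 0, t_± = (1 ± w)/h, and τ(t) = (1−tz)/(z−t). Then the series Σ_{l=0}^∞ h^l P(z, l+δ, 3) converges and equals (1/w) · [ F1(−δ, δ, 1; 1; (1−z)/2, (1−t_−)/2) + δ·((t_− − z)/2)·F1(1−δ, 1+δ, 1; 2; (1−z)/2, (1−τ(t_+))/2) ], where both Appell series converge since their arguments lie in (0,1). (Shifted generating-function formula in dimension D = 3.) -/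
open Filter

/-- Pochhammer symbol `(a)ₙ = a(a+1)⋯(a+n-1)` for complex `a`. -/
noncomputable def poch (a : ℂ) (n : ℕ) : ℂ := ∏ k ∈ Finset.range n, (a + k)

/-- Gauss hypergeometric series `₂F₁(a,b;c;x)`. -/
noncomputable def F21 (a b c x : ℂ) : ℂ :=
  ∑' n : ℕ, poch a n * poch b n / (poch c n * n.factorial) * x ^ n

/-- `D`-dimensional Legendre (Gegenbauer) function `P(z, ν, D)`. -/
noncomputable def legP (z ν : ℂ) (D : ℕ) : ℂ :=
  Complex.Gamma (ν + D - 2) / (Complex.Gamma (ν + 1) * Complex.Gamma ((D : ℂ) - 1)) *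
    F21 (-ν) (ν + (D : ℂ) - 2) (((D : ℂ) - 1) / 2) ((1 - z) / 2)

/-- Appell hypergeometric function `F1(a,b,b';c;x,y)` of two variables. -/
noncomputable def F1A (a b b' c x y : ℂ) : ℂ :=
  ∑' p : ℕ × ℕ, poch a (p.1 + p.2) * poch b p.1 * poch b' p.2 /
    (poch c (p.1 + p.2) * p.1.factorial * p.2.factorial) * x ^ p.1 * y ^ p.2

theorem hasSum_of_eq {ι : Type*} {f g : ι → ℂ} {a b : ℂ} (hf : HasSum f a)
    (hfg : ∀ i, g i = f i) (hab : b = a) : HasSum g b := by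
  rwa [hab, funext hfg]

theorem poch_eq_ascPochhammer_eval (a : ℂ) (n : ℕ) : poch a n = (ascPochhammer ℂ n).eval a := by
  induction n with
  | zero => simp [poch]
  | succ n ih => rw [ascPochhammer_succ_eval, ← ih, poch, Finset.prod_range_succ, poch]

theorem poch_div_factorial (a : ℂ) (n : ℕ) :
    poch a n / n.factorial = Ring.choose (a + n - 1) n := by
  rw [div_eq_iff (by exact_mod_cast n.factorial_ne_zero), ← Ring.multichoose_eq,
    poch_eq_ascPochhammer_eval]
  have := Ring.factorial_nsmul_multichoose_eq_ascPochhammer a n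
  rw [Polynomial.ascPochhammer_smeval_eq_eval, nsmul_eq_mul] at this
  rw [← this, mul_comm]

theorem poch_one (n : ℕ) : poch 1 n = n.factorial := by
  rw [poch_eq_ascPochhammer_eval]; exact ascPochhammer_eval_one ℂ n

theorem poch_succ_left (a : ℂ) (n : ℕ) : poch a (n + 1) = a * poch (a + 1) n := by
  simp only [poch, Finset.prod_range_succ', Nat.cast_zero, add_zero, Nat.cast_succ]
  rw [mul_comm]
  congr 1
  exact Finset.prod_congr rfl fun k _ => by ring

theorem poch_two (n : ℕ) : poch 2 n = (n + 1).factorial := by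
  have := poch_succ_left 1 n
  rw [poch_one, one_mul] at this
  rw [this]; norm_num

theorem hasSum_one_sub_cpow_neg (a : ℂ) {v : ℂ} (hv : ‖v‖ < 1) :
    HasSum (fun n : ℕ => poch a n / n.factorial * v ^ n) ((1 - v) ^ (-a)) := by
  have := (Complex.one_div_one_sub_cpow_hasFPowerSeriesOnBall_zero a).hasSum (y := v)
    (by simpa [enorm_eq_nnnorm, ← NNReal.coe_lt_one] using hv)
  simpa [poch_div_factorial, Complex.cpow_neg, mul_comm] using this

theorem summable_norm_poch (a : ℂ) {q : ℝ} (hq : q ∈ Set.Ioo (0 : ℝ) 1) :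
    Summable fun n : ℕ => ‖poch a n / n.factorial * (q : ℂ) ^ n‖ :=
  (hasSum_one_sub_cpow_neg a (v := q) (by simpa [abs_of_pos hq.1] using hq.2)).summable.norm

theorem integral_exp_neg_pow_mul_exp_pow (m n : ℕ) :
    ∫ θ in (0 : ℝ)..2 * Real.pi, Complex.exp (-(θ * Complex.I)) ^ m * Complex.exp (θ * Complex.I) ^ n
      = if m = n then 2 * (Real.pi : ℂ) else 0 := by
  have key : ∀ θ : ℝ, Complex.exp (-(θ * Complex.I)) ^ m * Complex.exp (θ * Complex.I) ^ n =
      Complex.exp ((((n : ℂ) - m) * Complex.I) * θ) := by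
    intro θ
    rw [← Complex.exp_nat_mul, ← Complex.exp_nat_mul, ← Complex.exp_add]
    congr 1; ring
  simp_rw [key]
  split_ifs with h
  · simp [h]
  · have hc : ((n : ℂ) - m) * Complex.I ≠ 0 :=
      mul_ne_zero (sub_ne_zero.2 (by exact_mod_cast Ne.symm h)) Complex.I_ne_zero
    rw [integral_exp_mul_complex hc]
    have : Complex.exp (((n : ℂ) - m) * Complex.I * ((2 * Real.pi : ℝ) : ℂ)) = 1 := by
      rw [Complex.exp_eq_one_iff]
      exact ⟨(n : ℤ) - m, by push_cast; ring⟩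
    rw [this]
    simp

theorem norm_exp_neg_mul_I (θ : ℝ) : ‖Complex.exp (-(θ * Complex.I))‖ = 1 := by
  simpa using Complex.norm_exp_ofReal_mul_I (-θ)

theorem hasSum_integral_smul_of_bounded {ι : Type*} [Countable ι] {b : ι → ℂ}
    (hb : Summable fun i => ‖b i‖) {e : ι → ℝ → ℂ} (he : ∀ i, Continuous (e i))
    (he' : ∀ i θ, ‖e i θ‖ ≤ 1) {f g : ℝ → ℂ} (hf : Continuous f)
    (hg : ∀ θ, HasSum (fun i => b i * e i θ) (g θ)) :
    HasSum (fun i => b i * ∫ θ in (0 : ℝ)..2 * Real.pi, f θ * e i θ)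
      (∫ θ in (0 : ℝ)..2 * Real.pi, f θ * g θ) := by
  obtain ⟨C, hC⟩ := isCompact_uIcc.exists_bound_of_continuousOn
    (hf.continuousOn (s := Set.uIcc 0 (2 * Real.pi)))
  have := intervalIntegral.hasSum_integral_of_dominated_convergence (μ := MeasureTheory.volume)
    (a := 0) (b := 2 * Real.pi) (F := fun i θ => f θ * (b i * e i θ)) (f := fun θ => f θ * g θ)
    (fun i _ => C * ‖b i‖)
    (fun i => (hf.mul (continuous_const.mul (he i))).aestronglyMeasurable)
    (fun i => Eventually.of_forall fun θ hθ => by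
      have h1 := hC θ (Set.uIoc_subset_uIcc hθ)
      rw [norm_mul, norm_mul]
      exact mul_le_mul h1 (mul_le_of_le_one_right (norm_nonneg _) (he' i θ)) (by positivity)
        ((norm_nonneg _).trans h1))
    (Eventually.of_forall fun θ _ => hb.mul_left C)
    (by simp)
    (Eventually.of_forall fun θ _ => (hg θ).mul_left (f θ))
  refine hasSum_of_eq this (fun i => ?_) rfl
  rw [← intervalIntegral.integral_const_mul]
  exact intervalIntegral.integral_congr fun θ _ => by ring

theorem hasSum_mul_of_fourier {ι : Type*} [Countable ι] {a : ℕ → ℂ} {b : ι → ℂ} (d : ι → ℕ)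
    (ha : Summable fun n => ‖a n‖) (hb : Summable fun i => ‖b i‖) {f g : ℝ → ℂ}
    (hfc : Continuous f)
    (hf : ∀ θ : ℝ, HasSum (fun n => a n * Complex.exp (-(θ * Complex.I)) ^ n) (f θ))
    (hg : ∀ θ : ℝ, HasSum (fun i => b i * Complex.exp (θ * Complex.I) ^ d i) (g θ)) :
    HasSum (fun i => a (d i) * b i)
      ((2 * (Real.pi : ℂ))⁻¹ * ∫ θ in (0 : ℝ)..2 * Real.pi, f θ * g θ) := by
  have coeff (n : ℕ) : ∫ θ in (0 : ℝ)..2 * Real.pi, f θ * Complex.exp (θ * Complex.I) ^ n =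
      2 * (Real.pi : ℂ) * a n := by
    have h1 := hasSum_integral_smul_of_bounded ha
      (e := fun n θ => Complex.exp (-(θ * Complex.I)) ^ n) (fun n => by fun_prop)
      (fun n θ => by simp [norm_exp_neg_mul_I])
      (f := fun θ => Complex.exp (θ * Complex.I) ^ n) (by fun_prop) hf
    have h2 : HasSum (fun m => a m * ∫ θ in (0 : ℝ)..2 * Real.pi,
        Complex.exp (θ * Complex.I) ^ n * Complex.exp (-(θ * Complex.I)) ^ m)
        (2 * (Real.pi : ℂ) * a n) := by
      simp_rw [mul_comm (Complex.exp (_ * Complex.I) ^ n), integral_exp_neg_pow_mul_exp_pow]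
      convert hasSum_ite_eq n (2 * (Real.pi : ℂ) * a n) using 2 with m
      split_ifs with h
      · subst h; ring
      · simp
    simp_rw [mul_comm (f _)]
    exact h1.unique h2
  have h := (hasSum_integral_smul_of_bounded hb
    (e := fun i θ => Complex.exp (θ * Complex.I) ^ d i) (fun n => by fun_prop)
    (fun i θ => by simp [Complex.norm_exp_ofReal_mul_I]) hfc hg).mul_left (2 * (Real.pi : ℂ))⁻¹
  simp_rw [coeff] at h
  have hpi : (Real.pi : ℂ) ≠ 0 := by exact_mod_cast Real.pi_ne_zero
  refine hasSum_of_eq h (fun i => ?_) rfl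
  field_simp

theorem norm_mul_exp_lt_one {q : ℝ} (hq : |q| < 1) (θ : ℝ) :
    ‖(q : ℂ) * Complex.exp (θ * Complex.I)‖ < 1 := by
  simpa [Complex.norm_exp_ofReal_mul_I] using hq

theorem norm_mul_exp_neg_lt_one {q : ℝ} (hq : |q| < 1) (θ : ℝ) :
    ‖(q : ℂ) * Complex.exp (-(θ * Complex.I))‖ < 1 := by
  simpa [norm_exp_neg_mul_I] using hq

theorem one_sub_mem_slitPlane {v : ℂ} (hv : ‖v‖ < 1) : 1 - v ∈ Complex.slitPlane := by
  simpa [sub_eq_add_neg] using Complex.mem_slitPlane_of_norm_lt_one (z := -v) (by simpa using hv)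

theorem one_sub_ne_zero_of_norm_lt_one {v : ℂ} (hv : ‖v‖ < 1) : 1 - v ≠ 0 :=
  Complex.slitPlane_ne_zero (one_sub_mem_slitPlane hv)

theorem continuous_one_sub_exp_neg_cpow {q : ℝ} (hq : |q| < 1) (a : ℂ) :
    Continuous fun θ : ℝ => (1 - q * Complex.exp (-(θ * Complex.I))) ^ a :=
  Continuous.cpow (by fun_prop) continuous_const
    fun θ => one_sub_mem_slitPlane (norm_mul_exp_neg_lt_one hq θ)

theorem continuous_one_sub_exp_cpow {q : ℝ} (hq : |q| < 1) (a : ℂ) :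
    Continuous fun θ : ℝ => (1 - q * Complex.exp (θ * Complex.I)) ^ a :=
  Continuous.cpow (by fun_prop) continuous_const
    fun θ => one_sub_mem_slitPlane (norm_mul_exp_lt_one hq θ)

theorem continuous_one_sub_exp_inv {q : ℝ} (hq : |q| < 1) :
    Continuous fun θ : ℝ => (1 - q * Complex.exp (θ * Complex.I))⁻¹ :=
  Continuous.inv₀ (by fun_prop)
    fun θ => one_sub_ne_zero_of_norm_lt_one (norm_mul_exp_lt_one hq θ)

theorem hasSum_one_sub_exp_neg_cpow (a : ℂ) {q : ℝ} (hq : |q| < 1) (θ : ℝ) :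
    HasSum (fun n : ℕ => poch a n / n.factorial * (q : ℂ) ^ n *
      Complex.exp (-(θ * Complex.I)) ^ n) ((1 - q * Complex.exp (-(θ * Complex.I))) ^ (-a)) := by
  simpa only [mul_pow, mul_assoc] using hasSum_one_sub_cpow_neg a (norm_mul_exp_neg_lt_one hq θ)

theorem hasSum_one_sub_exp_cpow (a : ℂ) {q : ℝ} (hq : |q| < 1) (θ : ℝ) :
    HasSum (fun n : ℕ => poch a n / n.factorial * (q : ℂ) ^ n *
      Complex.exp (θ * Complex.I) ^ n) ((1 - q * Complex.exp (θ * Complex.I)) ^ (-a)) := by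
  simpa only [mul_pow, mul_assoc] using hasSum_one_sub_cpow_neg a (norm_mul_exp_lt_one hq θ)

theorem F21_one_eq_integral (a b : ℂ) {q : ℝ} (hq : q ∈ Set.Ioo (0 : ℝ) 1) :
    F21 a b 1 ((q : ℂ) ^ 2) = (2 * (Real.pi : ℂ))⁻¹ * ∫ θ in (0 : ℝ)..2 * Real.pi,
      (1 - q * Complex.exp (-(θ * Complex.I))) ^ (-a) *
        (1 - q * Complex.exp (θ * Complex.I)) ^ (-b) := by
  have hq' : |q| < 1 := abs_lt.2 ⟨by linarith [hq.1], hq.2⟩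
  rw [← (hasSum_mul_of_fourier (fun n : ℕ => n) (summable_norm_poch a hq) (summable_norm_poch b hq)
    (continuous_one_sub_exp_neg_cpow hq' _) (hasSum_one_sub_exp_neg_cpow a hq')
    (hasSum_one_sub_exp_cpow b hq')).tsum_eq, F21]
  refine tsum_congr fun n => ?_
  rw [poch_one]
  ring

theorem hasSum_appell_integral (s : ℕ) (a b : ℂ) {q r : ℝ} (hq : q ∈ Set.Ioo (0 : ℝ) 1)
    (hr : |r| < 1) :
    HasSum (fun p : ℕ × ℕ =>
      (poch a (p.1 + p.2 + s) / (p.1 + p.2 + s).factorial * (q : ℂ) ^ (p.1 + p.2 + s)) *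
        (poch b p.1 / p.1.factorial * (q : ℂ) ^ p.1 * (r : ℂ) ^ p.2))
      ((2 * (Real.pi : ℂ))⁻¹ * ∫ θ in (0 : ℝ)..2 * Real.pi,
        (1 - q * Complex.exp (-(θ * Complex.I))) ^ (-a) *
          (Complex.exp (θ * Complex.I) ^ s * ((1 - q * Complex.exp (θ * Complex.I)) ^ (-b) *
            (1 - r * Complex.exp (θ * Complex.I))⁻¹))) := by
  have hq' : |q| < 1 := abs_lt.2 ⟨by linarith [hq.1], hq.2⟩
  have hr' : Summable fun n : ℕ => ‖(r : ℂ) ^ n‖ := by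
    simpa using summable_geometric_of_lt_one (abs_nonneg r) hr
  have hb : Summable fun p : ℕ × ℕ =>
      ‖poch b p.1 / p.1.factorial * (q : ℂ) ^ p.1 * (r : ℂ) ^ p.2‖ :=
    (summable_norm_poch b hq).mul_norm hr'
  refine hasSum_mul_of_fourier (a := fun n => poch a n / n.factorial * (q : ℂ) ^ n)
    (b := fun p : ℕ × ℕ => poch b p.1 / p.1.factorial * (q : ℂ) ^ p.1 * (r : ℂ) ^ p.2)
    (fun p : ℕ × ℕ => p.1 + p.2 + s) (summable_norm_poch a hq) hb
    (continuous_one_sub_exp_neg_cpow hq' _) (hasSum_one_sub_exp_neg_cpow a hq') fun θ => ?_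
  have h1 := hasSum_one_sub_exp_cpow b hq' θ
  have h2 : HasSum (fun n : ℕ => (r : ℂ) ^ n * Complex.exp (θ * Complex.I) ^ n)
      (1 - r * Complex.exp (θ * Complex.I))⁻¹ := by
    simpa only [mul_pow] using hasSum_geometric_of_norm_lt_one (norm_mul_exp_lt_one hr θ)
  have hs := summable_mul_of_summable_norm h1.summable.norm h2.summable.norm
  refine hasSum_of_eq ((h1.mul h2 hs).mul_left (Complex.exp (θ * Complex.I) ^ s)) (fun p => ?_) rfl
  simp only [pow_add]
  ring

theorem F1A_one_eq_integral (a b : ℂ) {q r : ℝ} (hq : q ∈ Set.Ioo (0 : ℝ) 1) (hr : |r| < 1) :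
    F1A a b 1 1 ((q : ℂ) ^ 2) (q * r) =
      (2 * (Real.pi : ℂ))⁻¹ * ∫ θ in (0 : ℝ)..2 * Real.pi,
        (1 - q * Complex.exp (-(θ * Complex.I))) ^ (-a) *
          ((1 - q * Complex.exp (θ * Complex.I)) ^ (-b) *
            (1 - r * Complex.exp (θ * Complex.I))⁻¹) := by
  have := (hasSum_appell_integral 0 a b hq hr).tsum_eq
  simp only [pow_zero, one_mul] at this
  rw [← this, F1A]
  refine tsum_congr fun p => ?_
  have := Nat.cast_ne_zero (R := ℂ).2 p.2.factorial_ne_zero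
  rw [poch_one, poch_one, add_zero]
  field_simp
  ring

theorem mul_F1A_two_eq_integral (a b : ℂ) {q r : ℝ} (hq : q ∈ Set.Ioo (0 : ℝ) 1) (hr : |r| < 1) :
    a * q * F1A (a + 1) b 1 2 ((q : ℂ) ^ 2) (q * r) =
      (2 * (Real.pi : ℂ))⁻¹ * ∫ θ in (0 : ℝ)..2 * Real.pi,
        (1 - q * Complex.exp (-(θ * Complex.I))) ^ (-a) *
          (Complex.exp (θ * Complex.I) * ((1 - q * Complex.exp (θ * Complex.I)) ^ (-b) *
            (1 - r * Complex.exp (θ * Complex.I))⁻¹)) := by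
  have := (hasSum_appell_integral 1 a b hq hr).tsum_eq
  simp only [pow_one] at this
  rw [← this, F1A, ← tsum_mul_left]
  refine tsum_congr fun p => ?_
  have := Nat.cast_ne_zero (R := ℂ).2 p.2.factorial_ne_zero
  rw [poch_one, poch_two, poch_succ_left]
  field_simp
  ring

theorem integral_deriv_ratio_cpow {q : ℝ} (hq : |q| < 1) {a : ℂ} (ha : a ≠ 0) :
    ∫ θ in (0 : ℝ)..2 * Real.pi,
      (1 - q * Complex.exp (-(θ * Complex.I))) ^ a * (1 - q * Complex.exp (θ * Complex.I)) ^ (-a) *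
        (q * Complex.exp (-(θ * Complex.I)) * (1 - q * Complex.exp (-(θ * Complex.I)))⁻¹ +
          q * Complex.exp (θ * Complex.I) * (1 - q * Complex.exp (θ * Complex.I))⁻¹) = 0 := by
  have hd (θ : ℝ) : HasDerivAt (fun t : ℝ => (1 - q * Complex.exp (-(t * Complex.I))) ^ a *
      (1 - q * Complex.exp (t * Complex.I)) ^ (-a))
      (a * Complex.I * ((1 - q * Complex.exp (-(θ * Complex.I))) ^ a *
        (1 - q * Complex.exp (θ * Complex.I)) ^ (-a) *
        (q * Complex.exp (-(θ * Complex.I)) * (1 - q * Complex.exp (-(θ * Complex.I)))⁻¹ +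
          q * Complex.exp (θ * Complex.I) * (1 - q * Complex.exp (θ * Complex.I))⁻¹))) θ := by
    have hA := one_sub_mem_slitPlane (norm_mul_exp_neg_lt_one hq θ)
    have hB := one_sub_mem_slitPlane (norm_mul_exp_lt_one hq θ)
    have hI : HasDerivAt (fun t : ℂ => t * Complex.I) Complex.I (θ : ℂ) := by
      simpa using (hasDerivAt_id (θ : ℂ)).mul_const Complex.I
    have h1 := ((hI.neg.cexp.const_mul (q : ℂ)).const_sub 1).cpow_const (c := a) hA
    have h2 := ((hI.cexp.const_mul (q : ℂ)).const_sub 1).cpow_const (c := -a) hB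
    convert! (h1.mul h2).comp_ofReal using 1
    simp only [Pi.neg_apply]
    rw [Complex.cpow_sub _ _ (Complex.slitPlane_ne_zero hA),
      Complex.cpow_sub _ _ (Complex.slitPlane_ne_zero hB), Complex.cpow_one, Complex.cpow_one]
    ring
  have hcont : Continuous fun θ : ℝ =>
      (1 - q * Complex.exp (-(θ * Complex.I))) ^ a * (1 - q * Complex.exp (θ * Complex.I)) ^ (-a) *
        (q * Complex.exp (-(θ * Complex.I)) * (1 - q * Complex.exp (-(θ * Complex.I)))⁻¹ +
          q * Complex.exp (θ * Complex.I) * (1 - q * Complex.exp (θ * Complex.I))⁻¹) := by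
    have := continuous_one_sub_exp_inv hq
    have h' : Continuous fun θ : ℝ => (1 - q * Complex.exp (-(θ * Complex.I)))⁻¹ := by
      simpa [Complex.cpow_neg_one] using continuous_one_sub_exp_neg_cpow hq (-1)
    have := continuous_one_sub_exp_cpow hq (-a)
    have := continuous_one_sub_exp_neg_cpow hq a
    fun_prop
  have h := intervalIntegral.integral_eq_sub_of_hasDerivAt (a := 0) (b := 2 * Real.pi)
    (fun θ _ => hd θ) ((continuous_const.mul hcont).intervalIntegrable _ _)
  rw [intervalIntegral.integral_const_mul] at h
  have h0 : Complex.exp (-(((2 * Real.pi : ℝ) : ℂ) * Complex.I)) = 1 := by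
    rw [Complex.exp_neg]; simp [Complex.exp_two_pi_mul_I]
  have h1 : Complex.exp (((2 * Real.pi : ℝ) : ℂ) * Complex.I) = 1 := by
    simp [Complex.exp_two_pi_mul_I]
  rw [h0, h1] at h
  simp only [Complex.ofReal_zero, zero_mul, neg_zero, Complex.exp_zero, sub_self] at h
  exact (mul_eq_zero.1 h).resolve_left (mul_ne_zero ha Complex.I_ne_zero)

theorem legP_three_eq_integral {z q : ℝ} (hq : q ∈ Set.Ioo (0 : ℝ) 1) (hzq : q ^ 2 = (1 - z) / 2)
    {ν : ℂ} (hν : ∀ m : ℕ, ν + 1 ≠ -m) :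
    legP z ν 3 = (2 * (Real.pi : ℂ))⁻¹ * ∫ θ in (0 : ℝ)..2 * Real.pi,
      (1 - q * Complex.exp (-(θ * Complex.I))) ^ ν *
        (1 - q * Complex.exp (θ * Complex.I)) ^ (-(ν + 1)) := by
  have hx : (1 - (z : ℂ)) / 2 = (q : ℂ) ^ 2 := by exact_mod_cast hzq.symm
  have h := F21_one_eq_integral (-ν) (ν + 1) hq
  rw [neg_neg] at h
  have e1 : ν + ((3 : ℕ) : ℂ) - 2 = ν + 1 := by push_cast; ring
  have e2 : ((3 : ℕ) : ℂ) - 1 = 2 := by push_cast; ring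
  have e3 : Complex.Gamma 2 = 1 := by simp
  rw [← h, legP, hx, e1, e2, e3, mul_one, div_self (Complex.Gamma_ne_zero hν),
    one_mul, div_self two_ne_zero]

theorem legendre_kernel_identity {q r h e e' : ℂ} (he : e' * e = 1)
    (hh : h * r * (1 - q * r) = r - q) (hA : 1 - q * e' ≠ 0) (hB : 1 - q * e ≠ 0)
    (hr : 1 - r * e ≠ 0) (hAB : (1 - q * e) - h * (1 - q * e') ≠ 0) :
    ((1 - h + 2 * h * q * r) * (1 - q * e)⁻¹ + h * ((1 - q * e') * (1 - q * e)⁻¹) *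
        (q * e' * (1 - q * e')⁻¹ + q * e * (1 - q * e)⁻¹)) *
      (1 - h * ((1 - q * e') * (1 - q * e)⁻¹))⁻¹ =
    (1 - r * e)⁻¹ + (r - q) * (e * ((1 - q * e)⁻¹ * (1 - r * e)⁻¹)) := by
  have h1 : 1 - h * ((1 - q * e') * (1 - q * e)⁻¹) =
      ((1 - q * e) - h * (1 - q * e')) * (1 - q * e)⁻¹ := by field_simp
  have h2 : q * e' * (1 - q * e')⁻¹ + q * e * (1 - q * e)⁻¹ =
      (q * e' * (1 - q * e) + q * e * (1 - q * e')) * (1 - q * e')⁻¹ * (1 - q * e)⁻¹ := by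
    field_simp
  have key : ((1 - h + 2 * h * q * r) * (1 - q * e) +
      h * (q * e' * (1 - q * e) + q * e * (1 - q * e'))) * (1 - r * e) =
      ((1 - q * e) + (r - q) * e) * ((1 - q * e) - h * (1 - q * e')) := by
    have he0 : e ≠ 0 := right_ne_zero_of_mul_eq_one he
    obtain rfl : e' = e⁻¹ := eq_inv_of_mul_eq_one_left he
    field_simp
    linear_combination (2 * e ^ 2 - 2 * q * e ^ 3) * hh
  rw [h1, h2]
  generalize (1 - q * e) - h * (1 - q * e') = D at *
  generalize q * e' * (1 - q * e) + q * e * (1 - q * e') = M at *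
  generalize 1 - q * e' = A at *
  generalize hB' : 1 - q * e = B at *
  generalize hr' : 1 - r * e = R at *
  field_simp
  linear_combination key

theorem norm_one_sub_exp_neg (q θ : ℝ) :
    ‖1 - q * Complex.exp (-(θ * Complex.I))‖ = ‖1 - q * Complex.exp (θ * Complex.I)‖ := by
  rw [← Complex.norm_conj (1 - q * Complex.exp (θ * Complex.I))]
  congr 1
  simp [← Complex.exp_conj]

theorem hasSum_legP_generating {δ : ℂ} (hδ : ∀ m : ℤ, δ ≠ m) {z h q r : ℝ}
    (hq : q ∈ Set.Ioo (0 : ℝ) 1) (hzq : q ^ 2 = (1 - z) / 2) (hr : |r| < 1)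
    (hh : h ∈ Set.Ioo (0 : ℝ) 1) (hhr : h * r * (1 - q * r) = r - q) :
    HasSum (fun l : ℕ => (1 - h + 2 * h * q * r : ℂ) *
        ((h : ℂ) ^ l * legP z ((l : ℂ) + δ) 3))
      (F1A (-δ) δ 1 1 ((q : ℂ) ^ 2) (q * r) +
        δ * (q ^ 2 - q * r) * F1A (1 - δ) (1 + δ) 1 2 ((q : ℂ) ^ 2) (q * r)) := by
  have hq' : |q| < 1 := abs_lt.2 ⟨by linarith [hq.1], hq.2⟩
  have hA (θ : ℝ) := one_sub_ne_zero_of_norm_lt_one (norm_mul_exp_neg_lt_one hq' θ)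
  have hB (θ : ℝ) := one_sub_ne_zero_of_norm_lt_one (norm_mul_exp_lt_one hq' θ)
  have hR (θ : ℝ) := one_sub_ne_zero_of_norm_lt_one (norm_mul_exp_lt_one hr θ)
  have cA (a : ℂ) := continuous_one_sub_exp_neg_cpow hq' a
  have cB (a : ℂ) := continuous_one_sub_exp_cpow hq' a
  have cBi := continuous_one_sub_exp_inv hq'
  have cRi := continuous_one_sub_exp_inv hr
  have cAi : Continuous fun θ : ℝ => (1 - q * Complex.exp (-(θ * Complex.I)))⁻¹ := by
    simpa [Complex.cpow_neg_one] using cA (-1)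
  set A : ℝ → ℂ := fun θ => 1 - q * Complex.exp (-(θ * Complex.I)) with hAdef
  set B : ℝ → ℂ := fun θ => 1 - q * Complex.exp (θ * Complex.I) with hBdef
  set M : ℝ → ℂ := fun θ => q * Complex.exp (-(θ * Complex.I)) * (A θ)⁻¹ +
    q * Complex.exp (θ * Complex.I) * (B θ)⁻¹ with hM
  set w : ℂ := 1 - h + 2 * h * q * r with hw
  have cM : Continuous M := by fun_prop
  have cK : Continuous fun θ => A θ * (B θ)⁻¹ := by fun_prop
  have hK (θ : ℝ) : ‖A θ * (B θ)⁻¹‖ = 1 := by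
    rw [norm_mul, norm_inv, norm_one_sub_exp_neg, mul_inv_cancel₀ (norm_ne_zero_iff.2 (hB θ))]
  have hhK (θ : ℝ) : ‖(h : ℂ) * (A θ * (B θ)⁻¹)‖ < 1 := by
    rw [norm_mul, hK, mul_one, Complex.norm_real, Real.norm_of_nonneg hh.1.le]; exact hh.2
  set g : ℝ → ℂ := fun θ => A θ ^ δ * B θ ^ (-δ) *
    (w * (B θ)⁻¹ + h * (A θ * (B θ)⁻¹) * M θ) with hg
  have cg : Continuous g := by fun_prop
  have hsum := (hasSum_integral_smul_of_bounded (b := fun l : ℕ => (h : ℂ) ^ l)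
    (by simpa [abs_of_pos hh.1] using summable_geometric_of_lt_one hh.1.le hh.2)
    (e := fun l θ => (A θ * (B θ)⁻¹) ^ l) (fun l => cK.pow l)
    (fun l θ => by rw [norm_pow, hK, one_pow]) cg
    (g := fun θ => (1 - h * (A θ * (B θ)⁻¹))⁻¹)
    (fun θ => by simpa only [mul_pow] using hasSum_geometric_of_norm_lt_one (hhK θ))).mul_left
      (2 * (Real.pi : ℂ))⁻¹
  have shift (l : ℕ) (θ : ℝ) : A θ ^ ((l : ℂ) + δ) * B θ ^ (-((l : ℂ) + δ)) =
      A θ ^ δ * B θ ^ (-δ) * (A θ * (B θ)⁻¹) ^ l := by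
    rw [neg_add, Complex.cpow_add _ _ (hA θ), Complex.cpow_add _ _ (hB θ), Complex.cpow_natCast,
      Complex.cpow_neg (B θ) l, Complex.cpow_natCast, mul_pow, inv_pow]
    ring
  refine hasSum_of_eq hsum (fun l => ?_) ?_
  · have hν : (l : ℂ) + 1 + δ ≠ 0 := fun h0 => hδ (-(l + 1)) <| by
      push_cast; linear_combination h0
    have hP := legP_three_eq_integral hq hzq (ν := (l : ℂ) + δ) fun m hm => hδ (-(m + l + 1)) <| by
      push_cast; linear_combination hm
    have h0 := integral_deriv_ratio_cpow hq' hν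
    have hsplit : ∫ θ in (0 : ℝ)..2 * Real.pi, g θ * (A θ * (B θ)⁻¹) ^ l =
        w * (∫ θ in (0 : ℝ)..2 * Real.pi, A θ ^ ((l : ℂ) + δ) * B θ ^ (-((l : ℂ) + δ + 1))) +
        h * ∫ θ in (0 : ℝ)..2 * Real.pi,
          A θ ^ ((l : ℂ) + 1 + δ) * B θ ^ (-((l : ℂ) + 1 + δ)) * M θ := by
      rw [← intervalIntegral.integral_const_mul, ← intervalIntegral.integral_const_mul,
        ← intervalIntegral.integral_add (Continuous.intervalIntegrable (by fun_prop) _ _)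
          (Continuous.intervalIntegrable (by fun_prop) _ _)]
      refine intervalIntegral.integral_congr fun θ _ => ?_
      have s1 := shift l θ
      have s2 := shift (l + 1) θ
      rw [Nat.cast_succ] at s2
      have s3 : B θ ^ (-((l : ℂ) + δ + 1)) = B θ ^ (-((l : ℂ) + δ)) * (B θ)⁻¹ := by
        rw [neg_add (_ + _), Complex.cpow_add _ _ (hB θ), Complex.cpow_neg_one]
      simp only [hg]
      rw [s2, s3]
      linear_combination (-w * (B θ)⁻¹) * s1
    rw [hsplit, h0, hP]
    ring
  · have f1 := F1A_one_eq_integral (-δ) δ hq hr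
    have f2 := mul_F1A_two_eq_integral (-δ) (1 + δ) hq hr
    rw [neg_neg] at f1 f2
    have hsplit : ∫ θ in (0 : ℝ)..2 * Real.pi, g θ * (1 - h * (A θ * (B θ)⁻¹))⁻¹ =
        (∫ θ in (0 : ℝ)..2 * Real.pi, A θ ^ δ *
          (B θ ^ (-δ) * (1 - r * Complex.exp (θ * Complex.I))⁻¹)) +
        (r - q) * ∫ θ in (0 : ℝ)..2 * Real.pi, A θ ^ δ * (Complex.exp (θ * Complex.I) *
          (B θ ^ (-(1 + δ)) * (1 - r * Complex.exp (θ * Complex.I))⁻¹)) := by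
      rw [← intervalIntegral.integral_const_mul,
        ← intervalIntegral.integral_add (Continuous.intervalIntegrable (by fun_prop) _ _)
          (Continuous.intervalIntegrable (by fun_prop) _ _)]
      refine intervalIntegral.integral_congr fun θ _ => ?_
      have hAB : B θ - h * A θ ≠ 0 := fun h0 => one_sub_ne_zero_of_norm_lt_one (hhK θ) <| by
        have := hB θ
        change B θ ≠ 0 at this
        rw [← mul_assoc, ← sub_eq_zero.1 h0, mul_inv_cancel₀ this, sub_self]
      have key := legendre_kernel_identity (q := q) (r := r) (h := h)
        (e := Complex.exp (θ * Complex.I)) (e' := Complex.exp (-(θ * Complex.I)))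
        (by rw [← Complex.exp_add]; simp) (by exact_mod_cast hhr) (hA θ) (hB θ) (hR θ) hAB
      have s3 : B θ ^ (-(1 + δ)) = (B θ)⁻¹ * B θ ^ (-δ) := by
        rw [neg_add, Complex.cpow_add _ _ (hB θ), Complex.cpow_neg_one]
      simp only [hg]
      rw [s3, mul_assoc (A θ ^ δ * B θ ^ (-δ)), key]
      ring
    rw [hsplit, mul_add, ← f1, mul_left_comm, ← f2, show 1 - δ = -δ + 1 by ring]
    ring

/-- Shifted generating-function formula in dimension `D = 3`: for `δ ∈ ℂ \ ℤ`,
`z ∈ (-1,1)`, `0 < h < 1`, with `w = √(1+h²-2hz)`, `t± = (1±w)/h`, `τ(t) = (1-tz)/(z-t)`,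
`Σ_l h^l P(z,l+δ,3) = (1/w)[F1(-δ,δ,1;1;(1-z)/2,(1-t₋)/2)
  + δ((t₋-z)/2)F1(1-δ,1+δ,1;2;(1-z)/2,(1-τ(t₊))/2)]`. -/
theorem stmt3 (δ : ℂ) (hδ : ∀ m : ℤ, δ ≠ m) (z h : ℝ)
    (hz : z ∈ Set.Ioo (-1 : ℝ) 1) (hh : h ∈ Set.Ioo (0 : ℝ) 1)
    (w tp tm : ℝ) (hw : w = Real.sqrt (1 + h ^ 2 - 2 * h * z))
    (htp : tp = (1 + w) / h) (htm : tm = (1 - w) / h) :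
    Tendsto (fun N : ℕ => ∑ l ∈ Finset.range N, (h : ℂ) ^ l * legP (z : ℂ) ((l : ℂ) + δ) 3)
      atTop
      (nhds ((1 / (w : ℂ)) *
        (F1A (-δ) δ 1 1 ((1 - (z : ℂ)) / 2) ((1 - (tm : ℂ)) / 2) +
          δ * (((tm : ℂ) - z) / 2) *
            F1A (1 - δ) (1 + δ) 1 2 ((1 - (z : ℂ)) / 2)
              ((1 - (1 - (tp : ℂ) * z) / ((z : ℂ) - tp)) / 2)))) := by
  have hz1 := hz.1
  have hz2 := hz.2
  have hh1 := hh.1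
  have hh2 := hh.2
  have hrad : 0 < 1 + h ^ 2 - 2 * h * z := by nlinarith [sq_nonneg (1 - h)]
  have hw2 : w ^ 2 = 1 + h ^ 2 - 2 * h * z := by rw [hw, Real.sq_sqrt hrad.le]
  have hw0 : 0 < w := by rw [hw]; exact Real.sqrt_pos.2 hrad
  have hwl : 1 - h < w := lt_of_pow_lt_pow_left₀ 2 hw0.le (by nlinarith)
  have hwu : w < 1 + h := lt_of_pow_lt_pow_left₀ 2 (by linarith) (by nlinarith)
  have htm' : h * tm = 1 - w := by rw [htm]; field_simp
  have htp' : h * tp = 1 + w := by rw [htp]; field_simp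
  have htm1 : tm < 1 := by nlinarith
  have htm2 : -1 < tm := by nlinarith
  have htp1 : 1 < tp := by nlinarith
  have hquad : h * (tm ^ 2 - 1) = 2 * (tm - z) := by
    apply mul_left_cancel₀ hh1.ne'
    linear_combination (h * tm + 1 - w) * htm' - 2 * htm' + hw2
  have hτ : (1 - tp * z) / (z - tp) = tm := by
    rw [div_eq_iff (by linarith)]
    apply mul_left_cancel₀ (pow_pos hh1 2).ne'
    linear_combination (-h * z + h * tm) * htp' + (-h * z + 1 + w) * htm' - hw2
  set q := Real.sqrt ((1 - z) / 2) with hqdef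
  have hq2 : q ^ 2 = (1 - z) / 2 := Real.sq_sqrt (by linarith)
  have hq0 : 0 < q := Real.sqrt_pos.2 (by linarith)
  have hq1 : q < 1 := lt_of_pow_lt_pow_left₀ 2 zero_le_one (by linarith)
  set r := (1 - tm) / 2 / q with hrdef
  have hqr : q * r = (1 - tm) / 2 := by rw [hrdef]; field_simp
  have hr0 : 0 < r := by apply div_pos _ hq0; linarith
  have hr1 : r < 1 := by
    rw [hrdef, div_lt_one hq0]
    have hpos : 0 < (1 - h) * (1 - tm ^ 2) := mul_pos (by linarith) (by nlinarith)
    exact lt_of_pow_lt_pow_left₀ 2 hq0.le (by rw [hq2]; linarith)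
  have hhr : h * r * (1 - q * r) = r - q := by
    apply mul_left_cancel₀ hq0.ne'
    have e : q * (h * r * (1 - q * r)) = h * (q * r) * (1 - q * r) := by ring
    rw [e, mul_sub q, ← sq, hqr, hq2]
    linear_combination (-1 / 4) * hquad
  have hwr : 1 - h + 2 * h * q * r = w := by
    rw [mul_assoc, hqr]
    linear_combination -htm'
  have key := hasSum_legP_generating hδ ⟨hq0, hq1⟩ hq2 (abs_lt.2 ⟨by linarith, hr1⟩) hh hhr
  have hwC : (1 - h + 2 * h * q * r : ℂ) = w := by exact_mod_cast hwr
  have hxC : (q : ℂ) ^ 2 = (1 - z) / 2 := by exact_mod_cast hq2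
  have hyC : (q : ℂ) * r = (1 - tm) / 2 := by exact_mod_cast hqr
  have hτC : (1 - (tp : ℂ) * z) / ((z : ℂ) - tp) = tm := by exact_mod_cast hτ
  have hwC0 : (w : ℂ) ≠ 0 := by exact_mod_cast hw0.ne'
  rw [hwC, hxC, hyC] at key
  rw [hτC]
  refine (hasSum_of_eq (key.mul_left (1 / (w : ℂ))) (fun l => ?_) ?_).tendsto_sum_nat
  · field_simp
  · ring
end

section
/- Let D ≥ 3 be an integer, let ν ∈ ℂ \ ℤ, and let z be real with |z| < 1. Then the series Σ_{n=0}^∞ (−2z)^n · Γ((n−ν)/2) · Γ((n+ν+D−2)/2) / n! converges absolutely, and P(z, ν, D) = −(sin(πν)/π) · (1/(4·Γ(D/2))) · Σ_{n=0}^∞ (−2z)^n Γ((n−ν)/2) Γ((n+ν+D−2)/2) / n!. (Power-series representation of the Legendre function of non-integer degree.) -/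
open Filter

theorem poch_succ (a : ℂ) (n : ℕ) : poch a (n + 1) = poch a n * (a + n) := by
  simp [poch, Finset.prod_range_succ]

theorem poch_add (a : ℂ) (m k : ℕ) : poch a (m + k) = poch a m * poch (a + m) k := by
  simp only [poch, Finset.prod_range_add]
  congr 1
  exact Finset.prod_congr rfl fun i _ => by push_cast; ring

theorem poch_ne_zero {a : ℂ} (ha : ∀ n : ℕ, a ≠ -n) (n : ℕ) : poch a n ≠ 0 :=
  Finset.prod_ne_zero_iff.mpr fun k _ h => ha k (eq_neg_of_add_eq_zero_left h)

theorem Gamma_mul_poch {a : ℂ} (ha : ∀ n : ℕ, a ≠ -n) (n : ℕ) :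
    Complex.Gamma a * poch a n = Complex.Gamma (a + n) := by
  induction n with
  | zero => simp [poch]
  | succ n ih =>
    have h : a + n ≠ 0 := fun h => ha n (eq_neg_of_add_eq_zero_left h)
    rw [poch_succ, ← mul_assoc, ih, Nat.cast_succ, ← add_assoc, Complex.Gamma_add_one _ h, mul_comm]

theorem shift_ne_neg {a : ℂ} (ha : ∀ n : ℕ, a ≠ -n) (m : ℕ) : ∀ n : ℕ, a + m ≠ -n := by
  intro n h
  apply ha (m + n)
  push_cast
  linear_combination h

/-- The coefficient of `x ^ n` in the Gauss hypergeometric series. -/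
noncomputable def hypCoeff (a b c : ℂ) (n : ℕ) : ℂ :=
  poch a n * poch b n / (poch c n * n.factorial)

theorem hypCoeff_succ {a b c : ℂ} (hc : ∀ n : ℕ, c ≠ -n) (n : ℕ) :
    hypCoeff a b c (n + 1) * ((n + 1) * (c + n)) = hypCoeff a b c n * ((a + n) * (b + n)) := by
  have h1 := poch_ne_zero hc n
  have h2 : c + n ≠ 0 := fun h => hc n (eq_neg_of_add_eq_zero_left h)
  have h3 : (n.factorial : ℂ) ≠ 0 := by exact_mod_cast n.factorial_ne_zero
  have h4 : (n : ℂ) + 1 ≠ 0 := by exact_mod_cast n.succ_ne_zero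
  simp only [hypCoeff, poch_succ, Nat.factorial_succ, Nat.cast_mul, Nat.cast_succ]
  field_simp

theorem hypCoeff_ne_zero {a b c : ℂ} (ha : ∀ n : ℕ, a ≠ -n) (hb : ∀ n : ℕ, b ≠ -n)
    (hc : ∀ n : ℕ, c ≠ -n) (n : ℕ) : hypCoeff a b c n ≠ 0 := by
  have h3 : (n.factorial : ℂ) ≠ 0 := by exact_mod_cast n.factorial_ne_zero
  exact div_ne_zero (mul_ne_zero (poch_ne_zero ha n) (poch_ne_zero hb n))
    (mul_ne_zero (poch_ne_zero hc n) h3)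

theorem hypCoeff_add {a b c : ℂ} (hc : ∀ n : ℕ, c ≠ -n) (m k : ℕ) :
    hypCoeff a b c (m + k) * ((m + k).choose m) =
      hypCoeff a b c m * hypCoeff (a + m) (b + m) (c + m) k := by
  have h1 := poch_ne_zero hc m
  have h2 := poch_ne_zero (shift_ne_neg hc m) k
  have h3 : (m.factorial : ℂ) ≠ 0 := by exact_mod_cast m.factorial_ne_zero
  have h4 : (k.factorial : ℂ) ≠ 0 := by exact_mod_cast k.factorial_ne_zero
  have h5 : ((m + k).factorial : ℂ) ≠ 0 := by exact_mod_cast (m + k).factorial_ne_zero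
  have h6 : ((m + k).choose m : ℂ) * (m.factorial * k.factorial) = (m + k).factorial := by
    have := Nat.choose_mul_factorial_mul_factorial (Nat.le_add_right m k)
    rw [Nat.add_sub_cancel_left] at this
    rw [← mul_assoc]
    exact_mod_cast this
  simp only [hypCoeff, poch_add]
  field_simp
  rw [← h6]
  ring

theorem tendsto_natCast_add_div (a c : ℂ) :
    Filter.Tendsto (fun n : ℕ => ‖a + n‖ / ‖c + n‖) Filter.atTop (nhds 1) := by
  have key : ∀ w : ℂ, Filter.Tendsto (fun n : ℕ => w / n + 1) Filter.atTop (nhds 1) := fun w => by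
    simpa using (tendsto_const_div_atTop_nhds_zero_nat w).add_const 1
  have h := ((key a).div (key c) one_ne_zero).norm
  simp only [div_one, norm_one] at h
  refine h.congr' ?_
  filter_upwards [Filter.eventually_ne_atTop 0] with n hn
  have hn' : (n : ℂ) ≠ 0 := by exact_mod_cast hn
  rw [← norm_div]
  simp only [Pi.div_apply]
  congr 1
  rw [div_add_one hn', div_add_one hn', div_div_div_cancel_right₀ hn']

theorem summable_norm_hypCoeff {a b c : ℂ} (ha : ∀ n : ℕ, a ≠ -n) (hb : ∀ n : ℕ, b ≠ -n)
    (hc : ∀ n : ℕ, c ≠ -n) {r : ℝ} (hr0 : 0 < r) (hr1 : r < 1) :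
    Summable fun n => ‖hypCoeff a b c n‖ * r ^ n := by
  have hne := hypCoeff_ne_zero ha hb hc
  refine summable_of_ratio_test_tendsto_lt_one hr1
    (Filter.Eventually.of_forall fun n => mul_ne_zero (norm_ne_zero_iff.mpr (hne n))
      (pow_ne_zero _ hr0.ne')) ?_
  have h := (((tendsto_natCast_add_div a 1).mul (tendsto_natCast_add_div b c)).mul_const r)
  simp only [one_mul] at h
  refine h.congr fun n => ?_
  have h2 : c + n ≠ 0 := fun h => hc n (eq_neg_of_add_eq_zero_left h)
  have h4 : (1 : ℂ) + n ≠ 0 := by rw [add_comm]; exact_mod_cast n.succ_ne_zero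
  have e := congrArg norm (hypCoeff_succ (a := a) (b := b) hc n)
  rw [add_comm (n : ℂ) 1] at e
  simp only [norm_mul] at e
  have h5 := norm_ne_zero_iff.mpr h2
  have h6 := norm_ne_zero_iff.mpr h4
  have h7 := norm_ne_zero_iff.mpr (hne n)
  simp only [norm_mul, norm_norm, norm_pow, Real.norm_of_nonneg hr0.le]
  field_simp
  linear_combination -r * r ^ n * e

theorem hasSum_F21 {a b c : ℂ} (ha : ∀ n : ℕ, a ≠ -n) (hb : ∀ n : ℕ, b ≠ -n)
    (hc : ∀ n : ℕ, c ≠ -n) {r : ℝ} (hr0 : 0 < r) (hr1 : r < 1) :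
    HasSum (fun n => hypCoeff a b c n * (r : ℂ) ^ n) (F21 a b c r) := by
  refine Summable.hasSum (Summable.of_norm ((summable_norm_hypCoeff ha hb hc hr0 hr1).congr ?_))
  intro n
  simp [abs_of_pos hr0]

theorem F21_half_shift {a b c : ℂ} (ha : ∀ n : ℕ, a ≠ -n) (hb : ∀ n : ℕ, b ≠ -n)
    (hc : ∀ n : ℕ, c ≠ -n) (habc : 2 * c = a + b + 1) :
    4 * (c * (c + 1)) * F21 a b c (1 / 2) =
      (a + 1) * (b + 1) * F21 (a + 2) (b + 2) (c + 2) (1 / 2) := by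
  have sum_half : ∀ m : ℕ, HasSum
      (fun k => hypCoeff (a + m) (b + m) (c + m) k * (1 / 2 : ℂ) ^ k)
      (F21 (a + m) (b + m) (c + m) (1 / 2)) := fun m => by
    simpa using hasSum_F21 (shift_ne_neg ha m) (shift_ne_neg hb m) (shift_ne_neg hc m)
      (r := 1 / 2) (by norm_num) (by norm_num)
  set T : ℕ → ℂ := fun n => hypCoeff a b c n * (1 / 2 : ℂ) ^ n with hT
  have h0 : HasSum T (F21 a b c (1 / 2)) := by simpa [hT] using sum_half 0
  have h2 : HasSum (fun n : ℕ => (n : ℂ) * (n - 1) * T n)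
      (hypCoeff a b c 2 / 2 * F21 (a + 2) (b + 2) (c + 2) (1 / 2)) := by
    rw [← hasSum_nat_add_iff' 2]
    have := (sum_half 2).mul_left (hypCoeff a b c 2 / 2)
    simp only [Nat.cast_ofNat] at this
    convert! this using 1
    · funext k
      have e := hypCoeff_add (a := a) (b := b) hc 2 k
      have hch : ((2 + k).choose 2 : ℂ) = (k + 2) * (k + 1) / 2 := by
        rw [Nat.cast_choose_two]; push_cast; ring
      rw [hch, add_comm 2 k] at e
      simp only [hT, Nat.cast_add, Nat.cast_ofNat, pow_add] at e ⊢
      linear_combination (1 / 2) * (1 / 2 : ℂ) ^ k * e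
    · simp [Finset.sum_range_succ]
  have h1 : Tendsto (fun n : ℕ => (n : ℂ) * T n) atTop (nhds 0) := by
    rw [← tendsto_add_atTop_iff_nat 1]
    have := ((sum_half 1).mul_left (hypCoeff a b c 1 / 2)).summable.tendsto_atTop_zero
    refine this.congr fun k => ?_
    have e := hypCoeff_add (a := a) (b := b) hc 1 k
    rw [Nat.choose_one_right, add_comm 1 k] at e
    simp only [hT, pow_succ]
    linear_combination (-1 / 2) * (1 / 2 : ℂ) ^ k * e
  have hU : Tendsto (fun n : ℕ => 2 * ((n : ℂ) * (n - 1) * T n) + 2 * c * (n * T n))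
      atTop (nhds 0) := by
    simpa using (h2.summable.tendsto_atTop_zero.const_mul 2).add (h1.const_mul (2 * c))
  have hpartial : ∀ N : ℕ, ∑ n ∈ Finset.range N, (a * b * T n - (n : ℂ) * (n - 1) * T n) =
      2 * ((N : ℂ) * (N - 1) * T N) + 2 * c * (N * T N) := fun N => by
    induction N with
    | zero => simp
    | succ n ih =>
      have e := hypCoeff_succ (a := a) (b := b) hc n
      rw [Finset.sum_range_succ, ih]
      simp only [hT, pow_succ]
      push_cast
      linear_combination (-(1 / 2 : ℂ) ^ n) * e + hypCoeff a b c n * (1 / 2) ^ n * n * habc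
  have hlim := ((h0.mul_left (a * b)).sub h2).tendsto_sum_nat
  have key := tendsto_nhds_unique hlim (hU.congr fun N => (hpartial N).symm)
  have ha0 : a ≠ 0 := by simpa using ha 0
  have hb0 : b ≠ 0 := by simpa using hb 0
  have hc0 : c ≠ 0 := by simpa using hc 0
  have hc1 : c + 1 ≠ 0 := fun h => hc 1 (by simpa using eq_neg_of_add_eq_zero_left h)
  simp only [hypCoeff, poch, Finset.prod_range_succ, Finset.prod_range_zero, one_mul,
    Nat.cast_zero, add_zero, Nat.cast_one, Nat.factorial_two, Nat.cast_ofNat] at key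
  field_simp at key
  rw [mul_zero, mul_eq_zero, or_iff_right (mul_ne_zero ha0 hb0)] at key
  linear_combination key

theorem hasSum_F21_recenter {a b c : ℂ} (ha : ∀ n : ℕ, a ≠ -n) (hb : ∀ n : ℕ, b ≠ -n)
    (hc : ∀ n : ℕ, c ≠ -n) {z : ℂ} (hz : ‖z‖ < 1) :
    HasSum (fun m : ℕ => hypCoeff a b c m * (-z / 2) ^ m *
      F21 (a + m) (b + m) (c + m) (1 / 2)) (F21 a b c ((1 - z) / 2)) := by
  set g : ℕ × ℕ → ℂ := fun p =>
    hypCoeff a b c p.1 * (1 / 2) ^ p.1 * ((p.1.choose p.2 : ℂ) * (-z) ^ p.2) with hg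
  have hvanish : ∀ (w : ℂ) (n m : ℕ), m ∉ Finset.range (n + 1) →
      (n.choose m : ℂ) * w ^ m = 0 := fun w n m hm => by
    rw [Nat.choose_eq_zero_of_lt (by simpa using hm)]; simp
  have hbinom : ∀ (w : ℂ) (n : ℕ), HasSum (fun m => (n.choose m : ℂ) * w ^ m) ((1 + w) ^ n) :=
    fun w n => by
      have e : (1 + w) ^ n = ∑ m ∈ Finset.range (n + 1), (n.choose m : ℂ) * w ^ m := by
        rw [add_comm, add_pow]
        simp [mul_comm]
      exact e ▸ hasSum_sum_of_ne_finset_zero (hvanish w n)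
  have hbinomR : ∀ n : ℕ, HasSum (fun m => ‖(n.choose m : ℂ) * (-z) ^ m‖) ((1 + ‖z‖) ^ n) :=
    fun n => by
      have := hbinom (‖z‖ : ℂ) n
      rw [← Complex.hasSum_ofReal]
      convert! this using 1
      · funext m; simp
      · simp
  have hnorm : Summable fun p => ‖g p‖ := by
    rw [summable_prod_of_nonneg fun _ => norm_nonneg _]
    have e : ∀ n : ℕ, HasSum (fun m => ‖g (n, m)‖) (‖hypCoeff a b c n‖ * ((1 + ‖z‖) / 2) ^ n) :=
      fun n => by
        convert! (hbinomR n).mul_left (‖hypCoeff a b c n‖ * (1 / 2) ^ n) using 1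
        · funext m; simp [hg]
        · simp only [div_pow, one_pow]; ring
    refine ⟨fun n => (e n).summable, ?_⟩
    simp only [(e _).tsum_eq]
    exact summable_norm_hypCoeff ha hb hc (by positivity) (by linarith)
  have hgs : Summable g := hnorm.of_norm
  have hrow : ∀ n, HasSum (fun m => g (n, m)) (hypCoeff a b c n * ((1 - z) / 2) ^ n) := fun n => by
    convert! (hbinom (-z) n).mul_left (hypCoeff a b c n * (1 / 2) ^ n) using 1
    rw [mul_assoc, ← mul_pow]
    ring_nf
  have hcol : ∀ m, HasSum (fun n => g (n, m)) (hypCoeff a b c m * (-z / 2) ^ m *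
      F21 (a + m) (b + m) (c + m) (1 / 2)) := fun m => by
    rw [← hasSum_nat_add_iff' m]
    have := (hasSum_F21 (shift_ne_neg ha m) (shift_ne_neg hb m) (shift_ne_neg hc m)
      (r := 1 / 2) (by norm_num) (by norm_num)).mul_left (hypCoeff a b c m * (-z / 2) ^ m)
    convert! this using 1
    · funext k
      have e := hypCoeff_add (a := a) (b := b) hc m k
      rw [add_comm m k] at e
      simp only [hg, pow_add, div_pow, one_pow, Complex.ofReal_div, Complex.ofReal_one,
        Complex.ofReal_ofNat]
      linear_combination (1 / 2 ^ k * (1 / 2 ^ m) * (-z) ^ m) * e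
    · rw [Finset.sum_eq_zero fun i hi => ?_]
      · simp
      · simp only [hg]
        rw [Nat.choose_eq_zero_of_lt (by simpa using hi)]
        simp
  have htot : F21 a b c ((1 - z) / 2) = ∑' p, g p :=
    (hgs.hasSum.prod_fiberwise hrow).tsum_eq
  rw [htot]
  exact HasSum.prod_fiberwise ((Equiv.prodComm ℕ ℕ).hasSum_iff.mpr hgs.hasSum) hcol

theorem hasSum_one_div_one_sub_cpow (p : ℂ) {x : ℂ} (hx : ‖x‖ < 1) :
    HasSum (fun n : ℕ => poch p n / n.factorial * x ^ n) (1 / (1 - x) ^ p) := by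
  have hch : ∀ n : ℕ, Ring.choose (p + n - 1) n = poch p n / n.factorial := fun n => by
    have h3 : (n.factorial : ℂ) ≠ 0 := by exact_mod_cast n.factorial_ne_zero
    rw [eq_div_iff h3, mul_comm, ← nsmul_eq_mul, Ring.choose,
      Ring.factorial_nsmul_multichoose_eq_ascPochhammer,
      show p + n - 1 - n + 1 = p by ring, Polynomial.ascPochhammer_smeval_eq_eval]
    induction n with
    | zero => simp [poch]
    | succ n ih =>
      have h3 : (n.factorial : ℂ) ≠ 0 := by exact_mod_cast n.factorial_ne_zero
      rw [ascPochhammer_succ_eval, ih h3, poch_succ]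
  have h := (Complex.one_div_one_sub_cpow_hasFPowerSeriesOnBall_zero p).hasSum
    (y := x) (by
      simpa [Metric.mem_eball, edist_zero_right, enorm_eq_nnnorm, ← NNReal.coe_lt_coe] using hx)
  simpa [FormalMultilinearSeries.ofScalars_apply_eq, hch, mul_comm] using h

open MeasureTheory Set in
/-- The substitution `v = u² / (u² + (1 - u)²)` in the Beta integral. -/
theorem two_mul_integral_eq_betaIntegral (a b : ℂ) :
    2 * ∫ u in Ioo (0 : ℝ) 1, (u : ℂ) ^ (a - 1) * (1 - (u : ℂ)) ^ (b - 1) *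
      (1 / (1 - 2 * (u : ℂ) * (1 - u)) ^ ((a + b) / 2)) =
      Complex.betaIntegral (a / 2) (b / 2) := by
  have hQ : ∀ u : ℝ, 0 < u ^ 2 + (1 - u) ^ 2 := fun u => by nlinarith [sq_nonneg (2 * u - 1)]
  have hderiv : ∀ u : ℝ, HasDerivAt (fun u : ℝ => u ^ 2 / (u ^ 2 + (1 - u) ^ 2))
      (2 * u * (1 - u) / (u ^ 2 + (1 - u) ^ 2) ^ 2) u := fun u => by
    have h1 : HasDerivAt (fun u : ℝ => u ^ 2) (2 * u) u := by simpa using hasDerivAt_pow 2 u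
    have h2 : HasDerivAt (fun u : ℝ => (1 - u) ^ 2) (-(2 * (1 - u))) u := by
      simpa using ((hasDerivAt_id' u).const_sub 1).fun_pow 2
    convert! h1.fun_div (h1.fun_add h2) (hQ u).ne' using 1
    congr 1
    ring
  have hsub := integral_Icc_deriv_smul_of_deriv_nonneg (a := 0) (b := 1)
    (g := fun v : ℝ => (v : ℂ) ^ (a / 2 - 1) * (1 - (v : ℂ)) ^ (b / 2 - 1))
    (fun u _ => (hderiv u).continuousAt.continuousWithinAt) (fun u _ => hderiv u)
    (fun u hu => div_nonneg (mul_nonneg (by linarith [hu.1]) (by linarith [hu.2])) (sq_nonneg _))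
    zero_le_one
  norm_num at hsub
  rw [Complex.betaIntegral, intervalIntegral.integral_of_le zero_le_one,
    ← integral_Icc_eq_integral_Ioc, ← hsub, integral_Icc_eq_integral_Ioo,
    ← integral_const_mul]
  refine setIntegral_congr_fun measurableSet_Ioo fun u hu => ?_
  have hu0 : 0 < u := hu.1
  have hu1 : 0 < 1 - u := by linarith [hu.2]
  have hcomp : 1 - u ^ 2 / (u ^ 2 + (1 - u) ^ 2) = (1 - u) ^ 2 / (u ^ 2 + (1 - u) ^ 2) := by
    rw [eq_div_iff (hQ u).ne', sub_mul, div_mul_cancel₀ _ (hQ u).ne']; ring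
  have hQ' : 1 - 2 * u * (1 - u) = u ^ 2 + (1 - u) ^ 2 := by ring
  have hcpow : ∀ (x : ℝ) (s : ℂ), 0 < x → (x : ℂ) ^ s = Complex.exp (Real.log x * s) :=
    fun x s hx => by
      rw [Complex.cpow_def_of_ne_zero (by exact_mod_cast hx.ne'), Complex.ofReal_log hx.le]
  have hexp : ∀ x : ℝ, 0 < x → (x : ℂ) = Complex.exp (Real.log x) := fun x hx => by
    rw [← Complex.ofReal_exp, Real.exp_log hx]
  have e1 : (1 : ℂ) - u = ((1 - u : ℝ) : ℂ) := by push_cast; ring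
  have e2 : (1 : ℂ) - 2 * u * ((1 - u : ℝ) : ℂ) = ((u ^ 2 + (1 - u) ^ 2 : ℝ) : ℂ) := by
    rw [← hQ']; push_cast; ring
  have e3 : (u : ℂ) ^ 2 / ((u ^ 2 + (1 - u) ^ 2 : ℝ) : ℂ) =
      ((u ^ 2 / (u ^ 2 + (1 - u) ^ 2) : ℝ) : ℂ) := by push_cast; ring
  have e4 : (1 : ℂ) - ((u ^ 2 / (u ^ 2 + (1 - u) ^ 2) : ℝ) : ℂ) =
      (((1 - u) ^ 2 / (u ^ 2 + (1 - u) ^ 2) : ℝ) : ℂ) := by rw [← hcomp]; push_cast; ring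
  have e5 : (u : ℂ) ^ 2 + ((1 - u : ℝ) : ℂ) ^ 2 = ((u ^ 2 + (1 - u) ^ 2 : ℝ) : ℂ) := by
    push_cast; ring
  simp only [e1, e2, e5]
  simp only [e3, e4]
  rw [hcpow _ _ hu0, hcpow _ _ hu1, hcpow _ _ (hQ u), hcpow _ _ (div_pos (pow_pos hu0 2) (hQ u)),
    hcpow _ _ (div_pos (pow_pos hu1 2) (hQ u)), Real.log_div (by positivity) (hQ u).ne',
    Real.log_div (by positivity) (hQ u).ne', Real.log_pow, Real.log_pow]
  generalize hL : Real.log u = L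
  generalize hM : Real.log (1 - u) = M
  generalize hN : Real.log (u ^ 2 + (1 - u) ^ 2) = N
  have f1 := hexp u hu0
  have f2 := hexp _ hu1
  have f3 := hexp _ (hQ u)
  rw [hL] at f1
  rw [hM] at f2
  rw [hN] at f3
  rw [f2, f3, f1, one_div, ← Complex.exp_neg]
  rw [← Complex.exp_nat_mul, div_eq_mul_inv _ (Complex.exp _), ← Complex.exp_neg]
  have : ∀ A B C A' B' C' D' E' : ℂ, A + B + C = A' + B' + C' + D' + E' →
      2 * (Complex.exp A * Complex.exp B * Complex.exp C) =
      2 * Complex.exp A' * Complex.exp B' * Complex.exp C' *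
        (Complex.exp D' * Complex.exp E') := by
    intro A B C A' B' C' D' E' h
    simp only [mul_assoc, ← Complex.exp_add]
    congr 2
    linear_combination h
  apply this
  push_cast
  ring

theorem ne_neg_natCast_of_re_pos {a : ℂ} (ha : 0 < a.re) (n : ℕ) : a ≠ -n := fun h => by
  have h' := congrArg Complex.re h
  have hn : (0 : ℝ) ≤ n := n.cast_nonneg
  rw [Complex.neg_re, Complex.natCast_re] at h'
  linarith

open MeasureTheory Set in
theorem hasSum_poch_mul_betaIntegral {a b : ℂ} (ha : 0 < a.re) (hb : 0 < b.re) :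
    HasSum (fun n : ℕ => poch ((a + b) / 2) n / n.factorial * 2 ^ n *
      Complex.betaIntegral (a + n) (b + n)) (Complex.betaIntegral (a / 2) (b / 2) / 2) := by
  set p : ℂ := (a + b) / 2 with hp
  have hp0 := ne_neg_natCast_of_re_pos (a := p) (by
    rw [hp, Complex.div_ofNat_re, Complex.add_re]; positivity)
  have h1 := ne_neg_natCast_of_re_pos (a := 1) (by simp)
  set w : ℕ → ℝ → ℂ := fun n u => (u : ℂ) ^ (a + n - 1) * (1 - (u : ℂ)) ^ (b + n - 1) with hw
  set F : ℕ → ℝ → ℂ := fun n u => poch p n / n.factorial * (2 * (u : ℂ) * (1 - u)) ^ n * w 0 u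
    with hF
  have hwint : ∀ n, IntegrableOn (w n) (Ioo 0 1) := fun n => by
    have h := Complex.betaIntegral_convergent (u := a + n) (v := b + n)
      (by simpa using by positivity) (by simpa using by positivity)
    rwa [intervalIntegrable_iff_integrableOn_Ioc_of_le zero_le_one,
      integrableOn_Ioc_iff_integrableOn_Ioo] at h
  have hFw : ∀ n, EqOn (F n) (fun u => poch p n / n.factorial * 2 ^ n * w n u) (Ioo 0 1) := by
    intro n u hu
    have hu0 : (u : ℂ) ≠ 0 := by exact_mod_cast hu.1.ne'
    have hu1 : (1 : ℂ) - u ≠ 0 := by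
      have : (1 : ℝ) - u ≠ 0 := by linarith [hu.2]
      exact_mod_cast this
    simp only [hF, hw]
    rw [show a + n - 1 = a + (0 : ℕ) - 1 + n by push_cast; ring,
      show b + n - 1 = b + (0 : ℕ) - 1 + n by push_cast; ring,
      Complex.cpow_add _ _ hu0, Complex.cpow_add _ _ hu1, Complex.cpow_natCast,
      Complex.cpow_natCast, mul_pow, mul_pow]
    ring
  have hFint : ∀ n, IntegrableOn (F n) (Ioo 0 1) := fun n =>
    IntegrableOn.congr_fun ((hwint n).const_mul _) (hFw n).symm measurableSet_Ioo
  have hFnorm : ∀ n, ∀ u ∈ Ioo (0 : ℝ) 1,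
      ‖F n u‖ ≤ ‖hypCoeff p 1 1 n‖ * (1 / 2) ^ n * ‖w 0 u‖ := by
    intro n u hu
    have h2 : ‖2 * (u : ℂ) * (1 - u)‖ ≤ 1 / 2 := by
      rw [show 2 * (u : ℂ) * (1 - u) = ((2 * u * (1 - u) : ℝ) : ℂ) by push_cast; ring,
        Complex.norm_of_nonneg
          (mul_nonneg (by linarith [hu.1]) (by linarith [hu.2]))]
      nlinarith [sq_nonneg (2 * u - 1)]
    simp only [hF, hypCoeff, norm_mul, norm_pow (2 * (u : ℂ) * (1 - u))]
    rw [mul_comm (poch p n), mul_div_mul_left _ _ (poch_ne_zero h1 n)]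
    simp only [norm_mul] at h2
    gcongr
  have hsum := hasSum_integral_of_summable_integral_norm (μ := volume.restrict (Ioo (0 : ℝ) 1))
    (F := F) hFint (Summable.of_nonneg_of_le (fun n => integral_nonneg fun _ => norm_nonneg _)
      (fun n => (setIntegral_mono_on (hFint n).norm ((hwint 0).norm.const_mul _) measurableSet_Ioo
        (hFnorm n)).trans_eq (integral_const_mul _ _))
      ((summable_norm_hypCoeff hp0 h1 h1 one_half_pos one_half_lt_one).mul_right _))
  convert! hsum using 1
  · funext n
    rw [setIntegral_congr_fun measurableSet_Ioo (hFw n), integral_const_mul,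
      Complex.betaIntegral, intervalIntegral.integral_of_le zero_le_one,
      integral_Ioc_eq_integral_Ioo]
  · rw [← two_mul_integral_eq_betaIntegral, mul_div_cancel_left₀ _ two_ne_zero]
    refine setIntegral_congr_fun measurableSet_Ioo fun u hu => ?_
    have h2 : ‖2 * (u : ℂ) * (1 - u)‖ < 1 := by
      rw [show 2 * (u : ℂ) * (1 - u) = ((2 * u * (1 - u) : ℝ) : ℂ) by push_cast; ring,
        Complex.norm_of_nonneg
          (mul_nonneg (by linarith [hu.1]) (by linarith [hu.2]))]
      nlinarith [sq_nonneg (2 * u - 1)]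
    simp only [hF]
    rw [((hasSum_one_div_one_sub_cpow p h2).mul_right (w 0 u)).tsum_eq]
    simp only [hw, Nat.cast_zero, add_zero]
    ring

theorem Gamma_mul_F21_half_of_re_pos {a b c : ℂ} (ha : 0 < a.re) (hb : 0 < b.re)
    (habc : 2 * c = a + b + 1) :
    (Real.sqrt Real.pi : ℂ) * Complex.Gamma a * Complex.Gamma b * F21 a b c (1 / 2) =
      2 ^ (a + b - 2) * Complex.Gamma c * Complex.Gamma (a / 2) * Complex.Gamma (b / 2) := by
  set p : ℂ := (a + b) / 2 with hp
  have hpre : 0 < p.re := by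
    rw [hp, Complex.div_ofNat_re, Complex.add_re]; positivity
  have hcp : c = p + 1 / 2 := by rw [hp]; linear_combination habc / 2
  have hcre : 0 < c.re := by
    have : (1 / 2 : ℂ).re = 1 / 2 := by norm_num
    rw [hcp, Complex.add_re, this]; positivity
  have ha' := ne_neg_natCast_of_re_pos ha
  have hb' := ne_neg_natCast_of_re_pos hb
  have hc' := ne_neg_natCast_of_re_pos hcre
  have hp' := ne_neg_natCast_of_re_pos hpre
  have hbeta := (hasSum_poch_mul_betaIntegral ha hb).mul_left
    (Complex.Gamma p * Complex.Gamma c * 2 ^ (a + b - 1))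
  have hF := (hasSum_F21 ha' hb' hc' (r := 1 / 2) (by norm_num) (by norm_num)).mul_left
    ((Real.sqrt Real.pi : ℂ) * Complex.Gamma a * Complex.Gamma b)
  have hterm : ∀ n : ℕ, (Real.sqrt Real.pi : ℂ) * Complex.Gamma a * Complex.Gamma b *
      (hypCoeff a b c n * ((1 / 2 : ℝ) : ℂ) ^ n) =
      Complex.Gamma p * Complex.Gamma c * 2 ^ (a + b - 1) *
        (poch p n / n.factorial * 2 ^ n * Complex.betaIntegral (a + n) (b + n)) := by
    intro n
    have g1 := Gamma_mul_poch ha' n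
    have g2 := Gamma_mul_poch hb' n
    have g3 := Gamma_mul_poch hc' n
    have g4 := Gamma_mul_poch hp' n
    have g5 := Complex.Gamma_mul_Gamma_eq_betaIntegral (s := a + n) (t := b + n)
      (by simpa using by positivity) (by simpa using by positivity)
    have g6 := Complex.Gamma_mul_Gamma_add_half (p + n)
    rw [show p + n + 1 / 2 = c + n by rw [hcp]; ring,
      show 2 * (p + n) = a + n + (b + n) by rw [hp]; ring] at g6
    have g7 : (2 : ℂ) ^ (1 - (a + n + (b + n))) * (2 ^ (a + b - 1) * 2 ^ n * 2 ^ n) = 1 := by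
      rw [← Complex.cpow_natCast, ← Complex.cpow_add _ _ two_ne_zero,
        ← Complex.cpow_add _ _ two_ne_zero, ← Complex.cpow_add _ _ two_ne_zero,
        show 1 - (a + n + (b + n)) + (a + b - 1 + n + n) = 0 by ring, Complex.cpow_zero]
    have h3 : (n.factorial : ℂ) ≠ 0 := by exact_mod_cast n.factorial_ne_zero
    have h4 := poch_ne_zero hc' n
    have h5 : (2 : ℂ) ^ n ≠ 0 := pow_ne_zero _ two_ne_zero
    rw [← g1, ← g2] at g5
    rw [← g3, ← g4] at g6
    simp only [hypCoeff, Complex.ofReal_div, Complex.ofReal_one, Complex.ofReal_ofNat, div_pow,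
      one_pow]
    field_simp
    generalize Complex.betaIntegral (a + n) (b + n) = B at *
    generalize Complex.Gamma (a + n + (b + n)) = G at *
    generalize (2 : ℂ) ^ (1 - (a + n + (b + n))) = P at *
    generalize (2 : ℂ) ^ (a + b - 1) = Q at *
    generalize (2 : ℂ) ^ n = R at *
    generalize (Real.sqrt Real.pi : ℂ) = S at *
    linear_combination S * g5 - S * G * B * g7 - Q * R * R * B * g6
  have hval := hF.unique (by simpa only [hterm] using hbeta)
  have g8 := Complex.Gamma_mul_Gamma_eq_betaIntegral (s := a / 2) (t := b / 2)
    (by rw [Complex.div_ofNat_re]; positivity) (by rw [Complex.div_ofNat_re]; positivity)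
  rw [← add_div] at g8
  have g9 : (2 : ℂ) ^ (a + b - 1) = 2 ^ (a + b - 2) * 2 := by
    rw [show a + b - 1 = a + b - 2 + 1 by ring, Complex.cpow_add _ _ two_ne_zero,
      Complex.cpow_one]
  rw [g9] at hval
  simp only [Complex.ofReal_div, Complex.ofReal_one, Complex.ofReal_ofNat] at hval
  rw [hval]
  linear_combination (-2 ^ (a + b - 2) * Complex.Gamma c) * g8

/-- **Gauss's second summation theorem**. -/
theorem Gamma_mul_F21_half {a b c : ℂ} (ha : ∀ n : ℕ, a ≠ -n) (hb : ∀ n : ℕ, b ≠ -n)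
    (hc : ∀ n : ℕ, c ≠ -n) (habc : 2 * c = a + b + 1) :
    (Real.sqrt Real.pi : ℂ) * Complex.Gamma a * Complex.Gamma b * F21 a b c (1 / 2) =
      2 ^ (a + b - 2) * Complex.Gamma c * Complex.Gamma (a / 2) * Complex.Gamma (b / 2) := by
  obtain ⟨k, hk⟩ : ∃ k : ℕ, 0 < a.re + 2 * k ∧ 0 < b.re + 2 * k := by
    obtain ⟨k, hk⟩ := exists_nat_gt (max (-a.re) (-b.re))
    have hk0 : (0 : ℝ) ≤ k := k.cast_nonneg
    have := max_lt_iff.mp hk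
    exact ⟨k, by linarith [this.1], by linarith [this.2]⟩
  induction k generalizing a b c with
  | zero =>
    simp only [Nat.cast_zero, mul_zero, add_zero] at hk
    exact Gamma_mul_F21_half_of_re_pos hk.1 hk.2 habc
  | succ k ih =>
    have hA := ih (a := a + 2) (b := b + 2) (c := c + 2)
      (by simpa using shift_ne_neg ha 2) (by simpa using shift_ne_neg hb 2)
      (by simpa using shift_ne_neg hc 2) (by linear_combination habc)
      (by
        push_cast at hk
        rw [Complex.add_re, Complex.add_re, Complex.re_ofNat]
        constructor <;> linarith [hk.1, hk.2])
    have hs := F21_half_shift ha hb hc habc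
    have ga := Gamma_mul_poch ha 2
    have gb := Gamma_mul_poch hb 2
    have gc := Gamma_mul_poch hc 2
    simp only [poch, Finset.prod_range_succ, Finset.prod_range_zero, one_mul,
      Nat.cast_zero, add_zero, Nat.cast_one, Nat.cast_ofNat] at ga gb gc
    have ha0 : a ≠ 0 := by simpa using ha 0
    have hb0 : b ≠ 0 := by simpa using hb 0
    have hc0 : c ≠ 0 := by simpa using hc 0
    have hc1 : c + 1 ≠ 0 := fun h => hc 1 (by simpa using eq_neg_of_add_eq_zero_left h)
    have h2 : (2 : ℂ) ^ (a + 2 + (b + 2) - 2) = 2 ^ (a + b - 2) * 16 := by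
      rw [show a + 2 + (b + 2) - 2 = a + b - 2 + (4 : ℕ) by push_cast; ring,
        Complex.cpow_add _ _ two_ne_zero, Complex.cpow_natCast]
      norm_num
    rw [← ga, ← gb, ← gc, h2, show (a + 2) / 2 = a / 2 + 1 by ring,
      show (b + 2) / 2 = b / 2 + 1 by ring, Complex.Gamma_add_one _ (div_ne_zero ha0 two_ne_zero),
      Complex.Gamma_add_one _ (div_ne_zero hb0 two_ne_zero)] at hA
    refine mul_left_cancel₀ (mul_ne_zero (mul_ne_zero ha0 hb0)
      (mul_ne_zero (by norm_num : (4 : ℂ) ≠ 0) (mul_ne_zero hc0 hc1))) ?_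
    linear_combination hA + (Real.sqrt Real.pi : ℂ) * Complex.Gamma a * Complex.Gamma b * a * b * hs

theorem hasSum_Gamma_mul_Gamma {a b c : ℂ} (ha : ∀ n : ℕ, a ≠ -n) (hb : ∀ n : ℕ, b ≠ -n)
    (hc : ∀ n : ℕ, c ≠ -n) (habc : 2 * c = a + b + 1) {z : ℂ} (hz : ‖z‖ < 1) :
    HasSum (fun m : ℕ => (-2 * z) ^ m * Complex.Gamma ((m + a) / 2) * Complex.Gamma ((m + b) / 2) /
        m.factorial)
      ((Real.sqrt Real.pi : ℂ) * Complex.Gamma a * Complex.Gamma b /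
        (2 ^ (a + b - 2) * Complex.Gamma c) * F21 a b c ((1 - z) / 2)) := by
  refine ((hasSum_F21_recenter ha hb hc hz).mul_left _).congr_fun fun m => ?_
  have hG := Gamma_mul_F21_half (shift_ne_neg ha m) (shift_ne_neg hb m) (shift_ne_neg hc m)
    (by linear_combination habc)
  have g1 := Gamma_mul_poch ha m
  have g2 := Gamma_mul_poch hb m
  have g3 := Gamma_mul_poch hc m
  have h3 : (m.factorial : ℂ) ≠ 0 := by exact_mod_cast m.factorial_ne_zero
  have h4 := poch_ne_zero hc m
  have h5 : (2 : ℂ) ^ m ≠ 0 := pow_ne_zero _ two_ne_zero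
  have h6 : (2 : ℂ) ^ (a + b - 2) ≠ 0 := by simp [Complex.cpow_eq_zero_iff]
  have h7 := Complex.Gamma_ne_zero hc
  have h2 : (2 : ℂ) ^ (a + m + (b + m) - 2) = 2 ^ (a + b - 2) * 2 ^ m * 2 ^ m := by
    rw [show a + m + (b + m) - 2 = a + b - 2 + m + m by ring,
      Complex.cpow_add _ _ two_ne_zero, Complex.cpow_add _ _ two_ne_zero, Complex.cpow_natCast]
  rw [h2, ← g1, ← g2, ← g3] at hG
  rw [hypCoeff, add_comm (m : ℂ) a, add_comm (m : ℂ) b, neg_mul, neg_pow, mul_pow, div_pow, neg_pow z]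
  field_simp
  linear_combination (-z ^ m) * hG

/-- Power-series representation of the Legendre function of non-integer degree:
for `D ≥ 3`, `ν ∈ ℂ \ ℤ`, `|z| < 1`, the series
`Σ_n (-2z)^n Γ((n-ν)/2) Γ((n+ν+D-2)/2)/n!` converges absolutely and
`P(z,ν,D) = -(sin(πν)/π)·(1/(4Γ(D/2)))·Σ`. -/
theorem stmt6 (D : ℕ) (hD : 3 ≤ D) (ν : ℂ) (hν : ∀ m : ℤ, ν ≠ m) (z : ℝ) (hz : |z| < 1) :
    Summable (fun n : ℕ => ‖(-2 * (z : ℂ)) ^ n * Complex.Gamma (((n : ℂ) - ν) / 2) *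
      Complex.Gamma (((n : ℂ) + ν + D - 2) / 2) / (n.factorial : ℂ)‖) ∧
    legP (z : ℂ) ν D =
      -(Complex.sin (Real.pi * ν) / (Real.pi : ℂ)) * (1 / (4 * Complex.Gamma ((D : ℂ) / 2))) *
        ∑' n : ℕ, (-2 * (z : ℂ)) ^ n * Complex.Gamma (((n : ℂ) - ν) / 2) *
          Complex.Gamma (((n : ℂ) + ν + D - 2) / 2) / (n.factorial : ℂ) := by
  have ha : ∀ n : ℕ, -ν ≠ -n := fun n h => hν n (by simpa using h)
  have hb : ∀ n : ℕ, ν + (D : ℂ) - 2 ≠ -n := fun n h => hν (2 - D - n) (by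
    push_cast
    linear_combination h)
  have hcre : 0 < (((D : ℂ) - 1) / 2).re := by
    have : (3 : ℝ) ≤ D := by exact_mod_cast hD
    rw [Complex.div_ofNat_re, Complex.sub_re, Complex.natCast_re, Complex.one_re]
    linarith
  have hc := ne_neg_natCast_of_re_pos hcre
  have hsum := hasSum_Gamma_mul_Gamma ha hb hc (by ring) (z := z) (by simpa using hz)
  have hfun : (fun n : ℕ => (-2 * (z : ℂ)) ^ n * Complex.Gamma (((n : ℂ) - ν) / 2) *
      Complex.Gamma (((n : ℂ) + ν + D - 2) / 2) / (n.factorial : ℂ)) =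
      fun n : ℕ => (-2 * (z : ℂ)) ^ n * Complex.Gamma (((n : ℂ) + -ν) / 2) *
      Complex.Gamma (((n : ℂ) + (ν + D - 2)) / 2) / (n.factorial : ℂ) := by
    funext n
    rw [← sub_eq_add_neg, ← add_sub_assoc, ← add_assoc]
  rw [← hfun] at hsum
  refine ⟨hsum.summable.norm, ?_⟩
  rw [hsum.tsum_eq, legP]
  have hrefl := Complex.Gamma_mul_Gamma_one_sub (-ν)
  have hdup := Complex.Gamma_mul_Gamma_add_half (((D : ℂ) - 1) / 2)
  rw [sub_neg_eq_add, add_comm 1 ν, mul_neg, Complex.sin_neg] at hrefl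
  rw [show ((D : ℂ) - 1) / 2 + 1 / 2 = D / 2 by ring,
    show 2 * (((D : ℂ) - 1) / 2) = D - 1 by ring] at hdup
  have hpow : (2 : ℂ) ^ (-ν + (ν + D - 2) - 2) * 2 ^ (1 - ((D : ℂ) - 1)) * 4 = 1 := by
    rw [← Complex.cpow_add _ _ two_ne_zero,
      show -ν + (ν + D - 2) - 2 + (1 - ((D : ℂ) - 1)) = -(2 : ℕ) by push_cast; ring,
      Complex.cpow_neg, Complex.cpow_natCast]
    norm_num
  have hG1 : Complex.Gamma (ν + 1) ≠ 0 := Complex.Gamma_ne_zero fun n h => hν (-n - 1) (by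
    push_cast
    linear_combination h)
  have hGa := Complex.Gamma_ne_zero ha
  have hGc := Complex.Gamma_ne_zero hc
  have hD' : (3 : ℝ) ≤ D := by exact_mod_cast hD
  have hGD : Complex.Gamma ((D : ℂ) / 2) ≠ 0 := Complex.Gamma_ne_zero_of_re_pos (by
    rw [Complex.div_ofNat_re, Complex.natCast_re]
    linarith)
  have hGD1 : Complex.Gamma ((D : ℂ) - 1) ≠ 0 := Complex.Gamma_ne_zero_of_re_pos (by
    rw [Complex.sub_re, Complex.natCast_re, Complex.one_re]
    linarith)
  have hpi : (Real.pi : ℂ) ≠ 0 := by exact_mod_cast Real.pi_ne_zero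
  have hsin : Complex.sin (Real.pi * ν) ≠ 0 := fun h => by
    rw [h, neg_zero, div_zero] at hrefl
    exact mul_ne_zero hGa hG1 hrefl
  have hP : (2 : ℂ) ^ (-ν + (ν + D - 2) - 2) ≠ 0 := by simp [Complex.cpow_eq_zero_iff]
  have hrefl' : Complex.Gamma (-ν) * Complex.Gamma (ν + 1) * Complex.sin (Real.pi * ν) =
      -Real.pi := by
    rw [hrefl, div_neg, neg_mul, div_mul_cancel₀ _ hsin]
  generalize (2 : ℂ) ^ (-ν + (ν + D - 2) - 2) = P at *
  generalize (2 : ℂ) ^ (1 - ((D : ℂ) - 1)) = R at *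
  generalize F21 (-ν) (ν + (D : ℂ) - 2) (((D : ℂ) - 1) / 2) ((1 - z) / 2) = X at *
  generalize Complex.Gamma (ν + D - 2) = Y at *
  field_simp
  rw [mul_comm ν]
  linear_combination 4 * Y * X * Real.pi * P * hdup +
    Y * X * Real.pi * Complex.Gamma ((D : ℂ) - 1) * Real.sqrt Real.pi * hpow +
    Y * X * Complex.Gamma ((D : ℂ) - 1) * Real.sqrt Real.pi * hrefl'
end
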